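/- arXiv:1704.02574 — 8 statements merged into one kernel-verified Lean document; each statement's English description precedes it below -/
import Mathlib

section
/- Let K be a finitely generated abelian group, let S ⊆ K be a finitely generated submonoid, and let x₁, …, x_r ∈ S be elements such that the elements x₁ ⊗ 1, …, x_r ⊗ 1 generate the cone cone(S) in K ⊗_ℤ ℚ. Define M := ι⁻¹({Σᵢ αᵢ (xᵢ ⊗ 1) : αᵢ ∈ ℚ, 0 ≤ αᵢ ≤ 1}) ⊆ K, where ι : K → K ⊗_ℤ ℚ, w ↦ w ⊗ 1. Then M is a finite subset of K, M is contained in the saturation S̃ of S, and S̃ = M + S, i.e. every element of S̃ can be written as m + s with m ∈ M and s ∈ S; in particular S̃ is a finitely generated S-module. -/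
open scoped TensorProduct

/-- The saturation of a submonoid `S` of an abelian group `K`:
all `w ∈ K` with `n • w ∈ S` for some integer `n ≥ 1`. -/
def saturation {K : Type} [AddCommGroup K] (S : AddSubmonoid K) : Set K :=
  {w | ∃ n : ℕ, 1 ≤ n ∧ n • w ∈ S}

/-- The cone generated by a submonoid `S ⊆ K` inside `K ⊗_ℤ ℚ`
(realised as `ℚ ⊗[ℤ] K`): all finite nonnegative rational combinations
of the elements `s ⊗ 1`, `s ∈ S`. -/
noncomputable def coneOf {K : Type} [AddCommGroup K] (S : AddSubmonoid K) :
    AddSubmonoid (ℚ ⊗[ℤ] K) :=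
  AddSubmonoid.closure {v | ∃ a : ℚ, ∃ s ∈ S, 0 ≤ a ∧ v = a • ((1 : ℚ) ⊗ₜ[ℤ] s)}

theorem exists_nsmul_eq_of_one_tmul_eq {K : Type*} [AddCommGroup K] {w w' : K}
    (h : (1 : ℚ) ⊗ₜ[ℤ] w = (1 : ℚ) ⊗ₜ[ℤ] w') : ∃ n : ℕ, 1 ≤ n ∧ n • w = n • w' := by
  have : IsLocalizedModule (nonZeroDivisors ℤ) (TensorProduct.mk ℤ ℚ K 1) :=
    (isLocalizedModule_iff_isBaseChange (nonZeroDivisors ℤ) ℚ _).2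
      (TensorProduct.isBaseChange ℤ K ℚ)
  obtain ⟨c, hc⟩ := (IsLocalizedModule.eq_iff_exists (nonZeroDivisors ℤ)
    (TensorProduct.mk ℤ ℚ K 1)).1 h
  have hc0 : (c : ℤ) ≠ 0 := nonZeroDivisors.ne_zero c.2
  have hc' : (c : ℤ) • w = (c : ℤ) • w' := hc
  refine ⟨(c : ℤ).natAbs, Nat.one_le_iff_ne_zero.2 (Int.natAbs_ne_zero.2 hc0), ?_⟩
  rcases Int.natAbs_eq (c : ℤ) with h1 | h1 <;> rw [h1] at hc' <;>
    simpa only [neg_smul, natCast_zsmul, neg_inj] using hc'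

theorem one_tmul_nsmul_eq_smul {K : Type*} [AddCommGroup K] (n : ℕ) (w : K) :
    (1 : ℚ) ⊗ₜ[ℤ] (n • w) = (n : ℚ) • ((1 : ℚ) ⊗ₜ[ℤ] w) := by
  rw [TensorProduct.tmul_smul, Nat.cast_smul_eq_nsmul]

theorem exists_nat_mul_eq_natCast {ι : Type*} [Fintype ι] (α : ι → ℚ) (hα : ∀ i, 0 ≤ α i) :
    ∃ N : ℕ, 1 ≤ N ∧ ∃ a : ι → ℕ, ∀ i, (N : ℚ) * α i = a i := by
  refine ⟨∏ i, (α i).den, Finset.one_le_prod' fun i _ => (α i).pos, ?_⟩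
  have (i : ι) : ∃ a : ℕ, ((∏ i, (α i).den : ℕ) : ℚ) * α i = a := by
    obtain ⟨c, hc⟩ := Finset.dvd_prod_of_mem (fun i => (α i).den) (Finset.mem_univ i)
    refine ⟨c * (α i).num.natAbs, ?_⟩
    have h1 : (((α i).num.natAbs : ℕ) : ℚ) = (α i).num := by
      rw [Nat.cast_natAbs, abs_of_nonneg (Rat.num_nonneg.2 (hα i))]
    rw [hc, Nat.cast_mul, Nat.cast_mul, h1, ← Rat.mul_den_eq_num]
    ring
  choose a ha using this
  exact ⟨a, ha⟩

theorem mem_saturation_of_one_tmul_eq {K : Type} [AddCommGroup K] {S : AddSubmonoid K}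
    {ι : Type*} [Fintype ι] {x : ι → K} (hx : ∀ i, x i ∈ S) {α : ι → ℚ} (hα : ∀ i, 0 ≤ α i)
    {w : K} (hw : (1 : ℚ) ⊗ₜ[ℤ] w = ∑ i, α i • ((1 : ℚ) ⊗ₜ[ℤ] x i)) : w ∈ saturation S := by
  obtain ⟨N, hN, a, ha⟩ := exists_nat_mul_eq_natCast α hα
  have h : (1 : ℚ) ⊗ₜ[ℤ] (N • w) = (1 : ℚ) ⊗ₜ[ℤ] (∑ i, a i • x i) := by
    rw [one_tmul_nsmul_eq_smul, hw, TensorProduct.tmul_sum, Finset.smul_sum]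
    exact Finset.sum_congr rfl fun i _ => by rw [one_tmul_nsmul_eq_smul, smul_smul, ha]
  obtain ⟨n, hn, hn'⟩ := exists_nsmul_eq_of_one_tmul_eq h
  refine ⟨n * N, Nat.mul_pos hn hN, ?_⟩
  rw [mul_smul, hn']
  exact S.nsmul_mem (S.sum_mem fun i _ => S.nsmul_mem (hx i) _) _

theorem one_tmul_mem_coneOf {K : Type} [AddCommGroup K] {S : AddSubmonoid K} {w : K}
    (hw : w ∈ saturation S) : (1 : ℚ) ⊗ₜ[ℤ] w ∈ coneOf S := by
  obtain ⟨n, hn, hnw⟩ := hw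
  refine AddSubmonoid.subset_closure ⟨(n : ℚ)⁻¹, n • w, hnw, by positivity, ?_⟩
  rw [one_tmul_nsmul_eq_smul, smul_smul, inv_mul_cancel₀ (by positivity), one_smul]

theorem apply_eq_sum_of_one_tmul_eq {K : Type*} [AddCommGroup K] {ι : Type*} [Fintype ι]
    {x : ι → K} {α : ι → ℚ} {w : K} (f : K →+ ℤ)
    (hw : (1 : ℚ) ⊗ₜ[ℤ] w = ∑ i, α i • ((1 : ℚ) ⊗ₜ[ℤ] x i)) :
    (f w : ℚ) = ∑ i, α i * f (x i) := by
  simpa [LinearMap.baseChange_tmul] using congrArg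
    (fun v => TensorProduct.AlgebraTensorModule.rid ℤ ℚ ℚ
      ((f.toIntLinearMap).baseChange ℚ v)) hw

theorem finite_setOf_one_tmul_mem_zonotope {K : Type*} [AddCommGroup K] (hK : AddGroup.FG K)
    {ι : Type*} [Fintype ι] (x : ι → K) :
    {w : K | ∃ α : ι → ℚ, (∀ i, 0 ≤ α i ∧ α i ≤ 1) ∧
      (1 : ℚ) ⊗ₜ[ℤ] w = ∑ i, α i • ((1 : ℚ) ⊗ₜ[ℤ] x i)}.Finite := by
  obtain ⟨n, κ, _, p, hp, e, ⟨E⟩⟩ := AddCommGroup.equiv_free_prod_directSum_zmod K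
  have (i : κ) : NeZero (p i ^ e i) := ⟨pow_ne_zero _ (hp i).ne_zero⟩
  have : Finite (DirectSum κ fun i => ZMod (p i ^ e i)) :=
    Finite.of_injective (fun v i => v i) DFunLike.coe_injective
  let f (j : Fin n) : K →+ ℤ :=
    (Finsupp.applyAddHom j).comp ((AddMonoidHom.fst _ _).comp E.toAddMonoidHom)
  let B (j : Fin n) : ℤ := ∑ i, |f j (x i)|
  let F (w : K) : (Fin n → ℤ) × DirectSum κ fun i => ZMod (p i ^ e i) :=
    (fun j => f j w, (E w).2)
  have hF : Function.Injective F := fun a b hab => E.injective <|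
    Prod.ext (Finsupp.ext fun j => congrFun (congrArg Prod.fst hab) j)
      (congrArg Prod.snd hab :)
  refine Set.Finite.of_finite_image (f := F) (Set.Finite.subset
    ((Set.finite_Icc (-B) B).prod Set.finite_univ) ?_) hF.injOn
  rintro _ ⟨w, ⟨α, hα, hw⟩, rfl⟩
  have key (j : Fin n) : |f j w| ≤ B j := by
    have h : (|f j w| : ℚ) ≤ ∑ i, |(f j (x i) : ℚ)| := by
      rw [apply_eq_sum_of_one_tmul_eq (f j) hw]
      refine (Finset.abs_sum_le_sum_abs _ _).trans (Finset.sum_le_sum fun i _ => ?_)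
      rw [abs_mul, abs_of_nonneg (hα i).1]
      exact mul_le_of_le_one_left (abs_nonneg _) (hα i).2
    exact_mod_cast h
  exact ⟨⟨fun j => (abs_le.1 (key j)).1, fun j => (abs_le.1 (key j)).2⟩, Set.mem_univ _⟩

/-- Lemma 2.2: if `x₁ ⊗ 1, …, x_r ⊗ 1` generate `cone(S)`, then
`M = ι⁻¹ {∑ αᵢ (xᵢ ⊗ 1) : 0 ≤ αᵢ ≤ 1}` is a finite subset of the saturation `S̃`
which generates `S̃` as an `S`-module: `S̃ = M + S`. -/
theorem lemma_2_2 {K : Type} [AddCommGroup K] (hK : AddGroup.FG K)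
    (S : AddSubmonoid K) (hS : S.FG) (r : ℕ) (x : Fin r → K) (hx : ∀ i, x i ∈ S)
    (hcone : (coneOf S : Set (ℚ ⊗[ℤ] K)) =
      {v | ∃ α : Fin r → ℚ, (∀ i, 0 ≤ α i) ∧ v = ∑ i, α i • ((1 : ℚ) ⊗ₜ[ℤ] x i)})
    (M : Set K)
    (hM : M = {w : K | ∃ α : Fin r → ℚ, (∀ i, 0 ≤ α i ∧ α i ≤ 1) ∧
      (1 : ℚ) ⊗ₜ[ℤ] w = ∑ i, α i • ((1 : ℚ) ⊗ₜ[ℤ] x i)}) :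
    M.Finite ∧ M ⊆ saturation S ∧
      saturation S = {w : K | ∃ m ∈ M, ∃ s ∈ S, w = m + s} := by
  subst hM
  have hsub : {w : K | ∃ α : Fin r → ℚ, (∀ i, 0 ≤ α i ∧ α i ≤ 1) ∧
      (1 : ℚ) ⊗ₜ[ℤ] w = ∑ i, α i • ((1 : ℚ) ⊗ₜ[ℤ] x i)} ⊆ saturation S := by
    rintro w ⟨α, hα, hw⟩
    exact mem_saturation_of_one_tmul_eq hx (fun i => (hα i).1) hw
  refine ⟨finite_setOf_one_tmul_mem_zonotope hK x, hsub, Set.Subset.antisymm ?_ ?_⟩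
  · intro w hw
    have hc : (1 : ℚ) ⊗ₜ[ℤ] w ∈ (coneOf S : Set (ℚ ⊗[ℤ] K)) := one_tmul_mem_coneOf hw
    rw [hcone] at hc
    obtain ⟨α, hα, hw⟩ := hc
    refine ⟨w - ∑ i, ⌊α i⌋₊ • x i, ⟨fun i => α i - ⌊α i⌋₊, fun i => ⟨?_, ?_⟩, ?_⟩,
      ∑ i, ⌊α i⌋₊ • x i, S.sum_mem fun i _ => S.nsmul_mem (hx i) _, (sub_add_cancel _ _).symm⟩
    · exact sub_nonneg.2 (Nat.floor_le (hα i))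
    · linarith [Nat.lt_floor_add_one (α i)]
    · simp only [TensorProduct.tmul_sub, TensorProduct.tmul_sum, one_tmul_nsmul_eq_smul, hw,
        sub_smul, Finset.sum_sub_distrib]
  · rintro _ ⟨m, hm, s, hs, rfl⟩
    obtain ⟨n, hn, hnm⟩ := hsub hm
    exact ⟨n, hn, by rw [smul_add]; exact S.add_mem hnm (S.nsmul_mem hs n)⟩
end

section
/- Let K be a finitely generated abelian group and let S ⊆ K be a finitely generated submonoid that generates K as a group (i.e. S is spanning). Then the conductor ideal c(S̃/S) := {x ∈ S : x + S̃ ⊆ S} is non-empty, where S̃ denotes the saturation of S. -/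
/-- The conductor ideal `c(S̃/S) = {x ∈ S : x + S̃ ⊆ S}`. -/
def conductorIdeal {K : Type} [AddCommGroup K] (S : AddSubmonoid K) : Set K :=
  {x | x ∈ S ∧ ∀ s ∈ saturation S, x + s ∈ S}

/-- A subset of a finitely generated abelian group is finite if every homomorphism to `ℤ` is
bounded on it. -/
theorem finite_of_forall_hom_bounded {K : Type} [AddCommGroup K] [AddGroup.FG K] (B : Set K)
    (hB : ∀ f : K →+ ℤ, ∃ C : ℤ, ∀ u ∈ B, |f u| ≤ C) : B.Finite := by
  obtain ⟨n, ι, _, p, hp, e, ⟨φ⟩⟩ := AddCommGroup.equiv_free_prod_directSum_zmod K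
  have (i : ι) : NeZero (p i ^ e i) := ⟨pow_ne_zero _ (hp i).ne_zero⟩
  let ψ : K → (Fin n → ℤ) × (∀ i : ι, ZMod (p i ^ e i)) := fun k => (⇑(φ k).1, ⇑(φ k).2)
  have hψ : Function.Injective ψ := by
    intro a b hab
    obtain ⟨h₁, h₂⟩ := Prod.ext_iff.mp hab
    exact φ.injective (Prod.ext (DFunLike.coe_injective h₁) (DFunLike.coe_injective h₂))
  choose C hC using fun j : Fin n => hB
    ((Finsupp.applyAddHom j).comp ((AddMonoidHom.fst _ _).comp φ.toAddMonoidHom))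
  refine Set.Finite.subset (((Set.finite_Icc (-C) C).prod Set.finite_univ).preimage
    hψ.injOn) fun u hu => ⟨⟨fun j => ?_, fun j => ?_⟩, Set.mem_univ _⟩
  · exact (abs_le.mp (hC j u hu)).1
  · exact (abs_le.mp (hC j u hu)).2

/-- The elements of `K` having a positive multiple `n • u` that is a combination of `T` with
coefficients in `[0, n)`. -/
def fundamentalBox {K : Type} [AddCommGroup K] (T : Finset K) : Set K :=
  {u | ∃ (n : ℕ) (r : K → ℕ), (∀ a, r a < n) ∧ n • u = ∑ a ∈ T, r a • a}

theorem fundamentalBox_finite {K : Type} [AddCommGroup K] [AddGroup.FG K] (T : Finset K) :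
    (fundamentalBox T).Finite := by
  refine finite_of_forall_hom_bounded _ fun f => ⟨∑ a ∈ T, |f a|, ?_⟩
  rintro u ⟨n, r, hr, hu⟩
  have hn : (0 : ℤ) < n := by exact_mod_cast (Nat.zero_le _).trans_lt (hr 0)
  have hfu : (n : ℤ) * f u = ∑ a ∈ T, (r a : ℤ) * f a := by
    simpa using congrArg f hu
  refine le_of_mul_le_mul_left ?_ hn
  calc (n : ℤ) * |f u| = |∑ a ∈ T, (r a : ℤ) * f a| := by rw [← hfu, abs_mul, abs_of_pos hn]
    _ ≤ ∑ a ∈ T, |(r a : ℤ) * f a| := Finset.abs_sum_le_sum_abs _ _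
    _ ≤ ∑ a ∈ T, (n : ℤ) * |f a| := Finset.sum_le_sum fun a _ => by
        rw [abs_mul, Nat.abs_cast]
        gcongr
        exact (hr a).le
    _ = n * ∑ a ∈ T, |f a| := (Finset.mul_sum ..).symm

theorem exists_add_fundamentalBox_of_mem_saturation {K : Type} [AddCommGroup K] (T : Finset K)
    {w : K} (hw : w ∈ saturation (AddSubmonoid.closure (T : Set K))) :
    ∃ u ∈ fundamentalBox T, ∃ s ∈ AddSubmonoid.closure (T : Set K), w = u + s := by
  obtain ⟨n, hn, hw⟩ := hw
  obtain ⟨c, -, hc⟩ := AddSubmonoid.mem_closure_finset.mp hw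
  refine ⟨w - ∑ a ∈ T, (c a / n) • a, ⟨n, fun a => c a % n, fun a => Nat.mod_lt _ hn, ?_⟩,
    ∑ a ∈ T, (c a / n) • a, sum_mem fun a ha => nsmul_mem (AddSubmonoid.subset_closure ha) _,
    (sub_add_cancel _ _).symm⟩
  rw [smul_sub, ← hc, Finset.smul_sum, ← Finset.sum_sub_distrib]
  refine Finset.sum_congr rfl fun a _ => ?_
  rw [sub_eq_iff_eq_add, ← mul_smul, ← add_smul, Nat.mod_add_div]

theorem exists_add_mem_of_closure_eq_top {K : Type} [AddCommGroup K] {S : AddSubmonoid K}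
    (hspan : AddSubgroup.closure (S : Set K) = ⊤) (u : K) : ∃ t ∈ S, t + u ∈ S := by
  have hu : u ∈ AddSubgroup.closure (S : Set K) := hspan ▸ AddSubgroup.mem_top u
  induction hu using AddSubgroup.closure_induction with
  | mem x hx => exact ⟨0, S.zero_mem, by simpa using hx⟩
  | zero => exact ⟨0, S.zero_mem, by simp⟩
  | add x y _ _ hx hy =>
    obtain ⟨s, hs, hsx⟩ := hx
    obtain ⟨t, ht, hty⟩ := hy
    exact ⟨s + t, add_mem hs ht, by simpa only [add_add_add_comm] using add_mem hsx hty⟩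
  | neg x _ hx =>
    obtain ⟨s, hs, hsx⟩ := hx
    exact ⟨s + x, hsx, by simpa using hs⟩

theorem exists_forall_add_mem_of_finite {K : Type} [AddCommGroup K] {S : AddSubmonoid K}
    (hspan : AddSubgroup.closure (S : Set K) = ⊤) {B : Set K} (hB : B.Finite) :
    ∃ x ∈ S, ∀ u ∈ B, x + u ∈ S := by
  induction B, hB using Set.Finite.induction_on with
  | empty => exact ⟨0, S.zero_mem, by simp⟩
  | @insert v B _ _ ih =>
    obtain ⟨x, hx, hxB⟩ := ih
    obtain ⟨t, ht, htv⟩ := exists_add_mem_of_closure_eq_top hspan v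
    refine ⟨x + t, add_mem hx ht, ?_⟩
    rintro u (rfl | hu)
    · simpa only [add_assoc] using add_mem hx htv
    · simpa only [add_right_comm] using add_mem (hxB u hu) ht

/-- Proposition 2.3: if a finitely generated submonoid `S` of a finitely
generated abelian group `K` generates `K` as a group, then the conductor
ideal `c(S̃/S)` is non-empty. -/
theorem conductorIdeal_nonempty {K : Type} [AddCommGroup K] (hK : AddGroup.FG K)
    (S : AddSubmonoid K) (hS : S.FG)
    (hspan : AddSubgroup.closure (S : Set K) = ⊤) :
    (conductorIdeal S).Nonempty := by
  obtain ⟨T, rfl⟩ := hS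
  obtain ⟨x, hx, hxB⟩ := exists_forall_add_mem_of_finite hspan (fundamentalBox_finite T)
  refine ⟨x, hx, fun w hw => ?_⟩
  obtain ⟨u, hu, s, hs, rfl⟩ := exists_add_fundamentalBox_of_mem_saturation T hw
  rw [← add_assoc]
  exact add_mem (hxB u hu) hs
end

section
/- Let K be a finitely generated abelian group, let K₁, K₂ ⊆ K be subgroups, and let S₁ ⊆ K₁ and S₂ ⊆ K₂ be finitely generated submonoids. Then the intersection S₁ ∩ S₂ is a finitely generated submonoid of K₁ ∩ K₂. -/
/-- A finitely generated additive submonoid is the image of some `ℕ ^ k`. -/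
theorem AddSubmonoid.FG.exists_mrange_eq {M : Type*} [AddCommMonoid M] {S : AddSubmonoid M}
    (hS : S.FG) : ∃ (s : Finset M) (f : (s → ℕ) →+ M), AddMonoidHom.mrange f = S := by
  obtain ⟨s, rfl⟩ := hS
  refine ⟨s, (Fintype.linearCombination ℕ (Subtype.val : s → M)).toAddMonoidHom, ?_⟩
  have h := congrArg Submodule.toAddSubmonoid
    (Fintype.range_linearCombination ℕ (Subtype.val : s → M))
  rw [Submodule.span_nat_eq_addSubmonoidClosure] at h
  exact h.trans (by simp)

/-- In a cancellative commutative additive monoid, the intersection of two finitely generated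
submonoids is finitely generated. -/
theorem AddSubmonoid.FG.inf {M : Type*} [AddCommMonoid M] [IsCancelAdd M]
    {S T : AddSubmonoid M} (hS : S.FG) (hT : T.FG) : (S ⊓ T).FG := by
  obtain ⟨s, f, rfl⟩ := hS.exists_mrange_eq
  obtain ⟨t, g, rfl⟩ := hT.exists_mrange_eq
  let F := f.comp (AddMonoidHom.fst (s → ℕ) (t → ℕ))
  let G := g.comp (AddMonoidHom.snd (s → ℕ) (t → ℕ))
  have h : (F.eqLocusM G).map F = AddMonoidHom.mrange f ⊓ AddMonoidHom.mrange g := by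
    ext x
    constructor
    · rintro ⟨⟨a, b⟩, hab, rfl⟩
      exact ⟨⟨a, rfl⟩, ⟨b, hab.symm⟩⟩
    · rintro ⟨⟨a, rfl⟩, ⟨b, hb⟩⟩
      exact ⟨(a, b), hb.symm, rfl⟩
  rw [← h]
  exact (AddSubmonoid.fg_eqLocusM F G).map F


/-- Lemma 2.4 (i): the intersection of two finitely generated submonoids
`S₁ ⊆ K₁`, `S₂ ⊆ K₂` of a finitely generated abelian group `K` is a
finitely generated submonoid of `K₁ ∩ K₂`. -/
theorem inter_fg {K : Type} [AddCommGroup K] (hK : AddGroup.FG K)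
    (K1 K2 : AddSubgroup K) (S1 S2 : AddSubmonoid K)
    (h1 : (S1 : Set K) ⊆ (K1 : Set K)) (h2 : (S2 : Set K) ⊆ (K2 : Set K))
    (hf1 : S1.FG) (hf2 : S2.FG) :
    ((S1 ⊓ S2 : AddSubmonoid K) : Set K) ⊆ ((K1 ⊓ K2 : AddSubgroup K) : Set K) ∧
      (S1 ⊓ S2).FG := by
  exact ⟨Set.inter_subset_inter h1 h2, hf1.inf hf2⟩
end

section
/- Let K be a finitely generated abelian group, let K₁, K₂ ⊆ K be subgroups, and let S₁ ⊆ K₁ and S₂ ⊆ K₂ be finitely generated submonoids such that Sᵢ generates Kᵢ as a group for i = 1, 2. Suppose the relative interiors of cone(S₁) and cone(S₂) intersect, in the following sense: there are generators s₁, …, s_{n₁} of the monoid S₁ and t₁, …, t_{n₂} of the monoid S₂ and strictly positive rational numbers a₁, …, a_{n₁}, b₁, …, b_{n₂} with Σᵢ aᵢ (sᵢ ⊗ 1) = Σⱼ bⱼ (tⱼ ⊗ 1) in K ⊗_ℤ ℚ. Then S₁ ∩ S₂ generates the group K₁ ∩ K₂, i.e. the subgroup of K generated by S₁ ∩ S₂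 equals K₁ ∩ K₂. -/
open scoped TensorProduct

/-- Finitely many positive rationals have a common positive denominator. -/
theorem exists_common_denominator {n : ℕ} (a : Fin n → ℚ) (ha : ∀ i, 0 < a i) :
    ∃ (D : ℕ) (A : Fin n → ℕ), 0 < D ∧ (∀ i, 0 < A i) ∧ ∀ i, (D : ℚ) * a i = A i := by
  have hD : ∀ i, (a i).den ∣ ∏ j, (a j).den := fun i =>
    Finset.dvd_prod_of_mem _ (Finset.mem_univ i)
  choose c hc using hD
  have hpos : 0 < ∏ j, (a j).den := Finset.prod_pos fun j _ => (a j).den_pos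
  refine ⟨∏ j, (a j).den, fun i => c i * (a i).num.toNat, hpos, fun i => ?_, fun i => ?_⟩
  · have hci : 0 < c i := Nat.pos_of_ne_zero fun h => by
      have := hc i
      rw [h, mul_zero] at this
      omega
    have hnum : 0 < (a i).num := Rat.num_pos.mpr (ha i)
    exact Nat.mul_pos hci (by omega)
  · have hnum : (((a i).num.toNat : ℕ) : ℚ) = (a i).num := by
      exact_mod_cast Int.toNat_of_nonneg (Rat.num_pos.mpr (ha i)).le
    rw [hc i]
    push_cast
    rw [hnum, ← Rat.den_mul_eq_num (a i)]
    ring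

/-- An element vanishing after tensoring with `ℚ` is torsion. -/
theorem exists_nsmul_eq_zero_of_one_tmul_eq_zero {K : Type*} [AddCommGroup K] {x : K}
    (hx : (1 : ℚ) ⊗ₜ[ℤ] x = 0) : ∃ m : ℕ, 0 < m ∧ m • x = 0 := by
  have hloc : IsLocalizedModule (nonZeroDivisors ℤ) (TensorProduct.mk ℤ ℚ K 1) :=
    (isLocalizedModule_iff_isBaseChange (nonZeroDivisors ℤ) ℚ _).mpr
      (TensorProduct.isBaseChange ℤ K ℚ)
  obtain ⟨c, hc⟩ :=
    (IsLocalizedModule.eq_zero_iff (nonZeroDivisors ℤ) (TensorProduct.mk ℤ ℚ K 1)).mp hx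
  refine ⟨(c : ℤ).natAbs, Int.natAbs_pos.mpr (nonZeroDivisors.ne_zero c.2), ?_⟩
  have hc' : (c : ℤ) • x = 0 := hc
  rcases Int.natAbs_eq (c : ℤ) with h | h <;> rw [h] at hc' <;> simpa using hc'

/-- Adding a large multiple of a strictly positive combination of the generators moves
any element of the generated group into the generated monoid. -/
theorem exists_add_nsmul_mem_closure {K : Type*} [AddCommGroup K] {n : ℕ} (s : Fin n → K)
    (A : Fin n → ℕ) (hA : ∀ i, 0 < A i) {x : K}
    (hx : x ∈ AddSubgroup.closure (Set.range s)) :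
    ∃ N : ℕ, x + N • ∑ i, A i • s i ∈ AddSubmonoid.closure (Set.range s) := by
  have hmem : ∀ i, s i ∈ AddSubmonoid.closure (Set.range s) := fun i =>
    AddSubmonoid.subset_closure ⟨i, rfl⟩
  set w := ∑ i, A i • s i with hw
  suffices h : (∃ N : ℕ, x + N • w ∈ AddSubmonoid.closure (Set.range s)) ∧
      ∃ N : ℕ, -x + N • w ∈ AddSubmonoid.closure (Set.range s) from h.1
  induction hx using AddSubgroup.closure_induction with
  | mem x hx =>
    obtain ⟨i, rfl⟩ := hx
    refine ⟨⟨0, by simpa using hmem i⟩, 1, ?_⟩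
    have hsplit : -s i + 1 • w = (A i - 1) • s i + ∑ j ∈ Finset.univ.erase i, A j • s j := by
      rw [one_nsmul, hw, ← Finset.add_sum_erase _ _ (Finset.mem_univ i)]
      obtain ⟨k, hk⟩ := Nat.exists_eq_add_of_lt (hA i)
      rw [hk, show 0 + k + 1 - 1 = k by omega, zero_add, succ_nsmul]
      abel
    rw [hsplit]
    exact add_mem (nsmul_mem (hmem i) _) (sum_mem fun j _ => nsmul_mem (hmem j) _)
  | zero => exact ⟨⟨0, by simp⟩, 0, by simp⟩
  | add x y _ _ hx hy =>
    obtain ⟨⟨N, hN⟩, M, hM⟩ := hx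
    obtain ⟨⟨N', hN'⟩, M', hM'⟩ := hy
    refine ⟨⟨N + N', ?_⟩, M + M', ?_⟩
    · rw [add_nsmul, add_add_add_comm]
      exact add_mem hN hN'
    · rw [add_nsmul, neg_add, add_add_add_comm]
      exact add_mem hM hM'
  | neg x _ hx => exact ⟨hx.2, by simpa using hx.1⟩

/-- The group generated by the monoid generated by `u` lies in the group generated by `u`. -/
theorem addSubgroup_closure_addSubmonoid_closure_le {K : Type*} [AddCommGroup K] (u : Set K) :
    AddSubgroup.closure (AddSubmonoid.closure u : Set K) ≤ AddSubgroup.closure u :=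
  (AddSubgroup.closure_le _).mpr <| show AddSubmonoid.closure u ≤
    (AddSubgroup.closure u).toAddSubmonoid from
      AddSubmonoid.closure_le.mpr AddSubgroup.subset_closure

/-- Two equal strictly positive rational combinations in `ℚ ⊗ K` come from equal
strictly positive integral combinations in `K`. -/
theorem exists_pos_nsmul_sum_eq {K : Type*} [AddCommGroup K] {n₁ n₂ : ℕ}
    (s : Fin n₁ → K) (t : Fin n₂ → K) (a : Fin n₁ → ℚ) (b : Fin n₂ → ℚ)
    (ha : ∀ i, 0 < a i) (hb : ∀ j, 0 < b j)
    (hmeet : ∑ i, a i • ((1 : ℚ) ⊗ₜ[ℤ] s i) = ∑ j, b j • ((1 : ℚ) ⊗ₜ[ℤ] t j)) :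
    ∃ (A : Fin n₁ → ℕ) (B : Fin n₂ → ℕ), (∀ i, 0 < A i) ∧ (∀ j, 0 < B j) ∧
      ∑ i, A i • s i = ∑ j, B j • t j := by
  obtain ⟨D, A, hD, hA, hDA⟩ := exists_common_denominator a ha
  obtain ⟨E, B, hE, hB, hEB⟩ := exists_common_denominator b hb
  have hcast : ∀ {n : ℕ} (u : Fin n → K) (C : Fin n → ℕ) (F : ℕ),
      (1 : ℚ) ⊗ₜ[ℤ] (∑ i, (F * C i) • u i) =
        ∑ i, ((F : ℚ) * C i) • ((1 : ℚ) ⊗ₜ[ℤ] u i) := fun u C F => by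
    rw [TensorProduct.tmul_sum]
    refine Finset.sum_congr rfl fun i _ => ?_
    rw [← Nat.cast_mul, Nat.cast_smul_eq_nsmul]
    exact map_nsmul (TensorProduct.mk ℤ ℚ K 1) _ _
  have hzero : (1 : ℚ) ⊗ₜ[ℤ] (∑ i, (E * A i) • s i - ∑ j, (D * B j) • t j) = 0 := by
    rw [TensorProduct.tmul_sub, hcast, hcast, sub_eq_zero]
    simp only [← hDA, ← hEB]
    have h := congrArg (((E : ℚ) * D) • ·) hmeet
    simp only [Finset.smul_sum, smul_smul] at h
    convert h using 3 <;> ring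
  obtain ⟨m, hm, hm0⟩ := exists_nsmul_eq_zero_of_one_tmul_eq_zero hzero
  refine ⟨fun i => m * (E * A i), fun j => m * (D * B j),
    fun i => by have := hA i; positivity, fun j => by have := hB j; positivity, ?_⟩
  rw [nsmul_sub, sub_eq_zero] at hm0
  simpa only [mul_nsmul', Finset.smul_sum] using hm0

/-- Proposition 2.5: if `S₁ ⊆ K₁` and `S₂ ⊆ K₂` are finitely generated
submonoids of a finitely generated abelian group `K` which generate `K₁`
resp. `K₂` as groups, and the relative interiors of `cone(S₁)` and
`cone(S₂)` meet (expressed via a common strictly positive rational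
combination of generators in `K ⊗_ℤ ℚ`), then `S₁ ∩ S₂` generates the
group `K₁ ∩ K₂`. -/
theorem inter_spanning {K : Type} [AddCommGroup K] (hK : AddGroup.FG K)
    (K1 K2 : AddSubgroup K) (S1 S2 : AddSubmonoid K)
    (h1 : (S1 : Set K) ⊆ (K1 : Set K)) (h2 : (S2 : Set K) ⊆ (K2 : Set K))
    (hspan1 : AddSubgroup.closure (S1 : Set K) = K1)
    (hspan2 : AddSubgroup.closure (S2 : Set K) = K2)
    (n1 n2 : ℕ) (s : Fin n1 → K) (t : Fin n2 → K)
    (hs : AddSubmonoid.closure (Set.range s) = S1)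
    (ht : AddSubmonoid.closure (Set.range t) = S2)
    (a : Fin n1 → ℚ) (b : Fin n2 → ℚ)
    (ha : ∀ i, 0 < a i) (hb : ∀ j, 0 < b j)
    (hmeet : ∑ i, a i • ((1 : ℚ) ⊗ₜ[ℤ] s i) = ∑ j, b j • ((1 : ℚ) ⊗ₜ[ℤ] t j)) :
    AddSubgroup.closure ((S1 ⊓ S2 : AddSubmonoid K) : Set K) = K1 ⊓ K2 := by
  obtain ⟨A, B, hA, hB, hAB⟩ := exists_pos_nsmul_sum_eq s t a b ha hb hmeet
  have hw1 : ∑ i, A i • s i ∈ S1 := sum_mem fun i _ =>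
    nsmul_mem (hs ▸ AddSubmonoid.subset_closure ⟨i, rfl⟩) _
  have hw2 : ∑ i, A i • s i ∈ S2 := hAB ▸ sum_mem fun j _ =>
    nsmul_mem (ht ▸ AddSubmonoid.subset_closure ⟨j, rfl⟩) _
  refine le_antisymm ((AddSubgroup.closure_le _).mpr fun x hx => ⟨h1 hx.1, h2 hx.2⟩) ?_
  rintro x ⟨hx1, hx2⟩
  rw [← hspan1, ← hs] at hx1
  rw [← hspan2, ← ht] at hx2
  have hx1' := addSubgroup_closure_addSubmonoid_closure_le _ hx1
  have hx2' := addSubgroup_closure_addSubmonoid_closure_le _ hx2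
  obtain ⟨N, hN⟩ := exists_add_nsmul_mem_closure s A hA hx1'
  obtain ⟨M, hM⟩ := exists_add_nsmul_mem_closure t B hB hx2'
  rw [hs] at hN
  rw [ht, ← hAB] at hM
  set w := ∑ i, A i • s i
  have hsum : x + (N + M) • w ∈ S1 ⊓ S2 := by
    constructor
    · rw [add_nsmul, ← add_assoc]
      exact add_mem hN (nsmul_mem hw1 M)
    · rw [add_comm N M, add_nsmul, ← add_assoc]
      exact add_mem hM (nsmul_mem hw2 N)
  have hw : (N + M) • w ∈ S1 ⊓ S2 := nsmul_mem (AddSubmonoid.mem_inf.mpr ⟨hw1, hw2⟩) _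
  simpa using sub_mem (AddSubgroup.subset_closure hsum) (AddSubgroup.subset_closure hw)
end

section
/- Let K be a finitely generated abelian group and let S ⊆ K be a finitely generated submonoid, generated by s₁, …, s_t, that generates K as a group. Let w ∈ K be such that w ⊗ 1 lies in the relative interior of cone(S), i.e. there are strictly positive rational numbers a₁, …, a_t with w ⊗ 1 = Σᵢ aᵢ (sᵢ ⊗ 1) in K ⊗_ℤ ℚ. Then there exists an integer r ≥ 1 such that r·w lies in the conductor ideal c(S̃/S). -/
open scoped TensorProduct

/-- In a finitely generated abelian group, only finitely many elements are averages of `n ≥ 1`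
with coefficients in `{0, …, n - 1}` of a given finite family. -/
theorem finite_setOf_nsmul_eq_sum_lt {K ι : Type*} [AddCommGroup K] [Fintype ι]
    [AddGroup.FG K] (s : ι → K) :
    {x : K | ∃ (n : ℕ) (c : ι → ℕ), (∀ i, c i < n) ∧ 1 ≤ n ∧ n • x = ∑ i, c i • s i}.Finite := by
  obtain ⟨d, κ, _, p, hp, k, ⟨φ⟩⟩ := AddCommGroup.equiv_free_prod_directSum_zmod K
  have (j : κ) : NeZero (p j ^ k j) := ⟨pow_ne_zero _ (hp j).ne_zero⟩
  have : Finite (DirectSum κ fun j ↦ ZMod (p j ^ k j)) :=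
    Finite.of_equiv _ (DirectSum.addEquivProd _).symm.toEquiv
  let coord (j : Fin d) : K →+ ℤ :=
    (Finsupp.applyAddHom j).comp ((AddMonoidHom.fst _ _).comp φ.toAddMonoidHom)
  let ψ : K → (Fin d → ℤ) × DirectSum κ fun j ↦ ZMod (p j ^ k j) :=
    fun x ↦ (fun j ↦ coord j x, (φ x).2)
  have hψ : Function.Injective ψ := by
    intro x y h
    apply φ.injective
    obtain ⟨h₁, h₂⟩ := Prod.ext_iff.mp h
    exact Prod.ext (Finsupp.ext fun j ↦ congrFun h₁ j) h₂
  let B : Fin d → ℤ := fun j ↦ ∑ i, |coord j (s i)|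
  refine Set.Finite.of_finite_image (f := ψ) ?_ hψ.injOn
  refine ((Set.finite_Icc (-B) B).prod (Set.finite_univ)).subset ?_
  rintro _ ⟨x, ⟨n, c, hc, hn, hx⟩, rfl⟩
  have key (j : Fin d) : |coord j x| ≤ B j := by
    have h : (n : ℤ) * coord j x = ∑ i, (c i : ℤ) * coord j (s i) := by
      simpa using congrArg (coord j) hx
    refine le_of_mul_le_mul_left ?_ (show (0 : ℤ) < n by lia)
    calc (n : ℤ) * |coord j x| = |∑ i, (c i : ℤ) * coord j (s i)| := by
          rw [← h, abs_mul, Nat.abs_cast]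
      _ ≤ ∑ i, |(c i : ℤ) * coord j (s i)| := Finset.abs_sum_le_sum_abs _ _
      _ ≤ ∑ i, (n : ℤ) * |coord j (s i)| := by
          refine Finset.sum_le_sum fun i _ ↦ ?_
          rw [abs_mul, Nat.abs_cast]
          have := hc i
          gcongr
      _ = n * B j := (Finset.mul_sum _ _ _).symm
  exact ⟨⟨fun j ↦ (abs_le.mp (key j)).1, fun j ↦ (abs_le.mp (key j)).2⟩, Set.mem_univ _⟩

/-- Elements of the saturation of a spanning finitely generated submonoid are integer combinations
of the generators with uniformly bounded below coefficients. -/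
theorem exists_forall_mem_saturation_eq_sum {K : Type} {ι : Type*} [AddCommGroup K] [Fintype ι]
    [AddGroup.FG K] (s : ι → K) (hspan : AddSubgroup.closure (Set.range s) = ⊤) :
    ∃ M : ℕ, ∀ x ∈ saturation (AddSubmonoid.closure (Set.range s)),
      ∃ e : ι → ℤ, (∀ i, -(M : ℤ) ≤ e i) ∧ x = ∑ i, e i • s i := by
  have hrep (x : K) : ∃ e : ι → ℤ, x = ∑ i, e i • s i :=
    AddSubgroup.exists_of_mem_closure_range s x (hspan ▸ AddSubgroup.mem_top x)
  choose e he using hrep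
  have hF := finite_setOf_nsmul_eq_sum_lt s
  obtain ⟨M, hM⟩ := (hF.image fun x ↦ ∑ i, (e x i).natAbs).bddAbove
  refine ⟨M, ?_⟩
  rintro x ⟨n, hn, hx⟩
  obtain ⟨c, hc⟩ := AddSubmonoid.exists_of_mem_closure_range s _ hx
  let y := x - ∑ i, (c i / n) • s i
  have hy : n • y = ∑ i, (c i % n) • s i := by
    rw [nsmul_sub, hc, Finset.smul_sum, ← Finset.sum_sub_distrib]
    refine Finset.sum_congr rfl fun i _ ↦ ?_
    rw [sub_eq_iff_eq_add, ← mul_nsmul', ← add_nsmul, Nat.mod_add_div]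
  have hyM : ∑ i, (e y i).natAbs ≤ M :=
    hM ⟨y, ⟨n, fun i ↦ c i % n, fun i ↦ Nat.mod_lt _ hn, hn, hy⟩, rfl⟩
  refine ⟨fun i ↦ e y i + (c i / n : ℕ), fun i ↦ ?_, ?_⟩
  · have := Finset.single_le_sum (f := fun i ↦ (e y i).natAbs) (fun _ _ ↦ Nat.zero_le _)
      (Finset.mem_univ i)
    have h0 : (0 : ℤ) ≤ (c i / n : ℕ) := Int.natCast_nonneg _
    lia
  · simp only [add_smul, Finset.sum_add_distrib, ← he, natCast_zsmul]
    exact (sub_add_cancel _ _).symm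

/-- A positive rational relation in `ℚ ⊗ K` lifts, up to a multiple, to a positive integral
relation in `K`. -/
theorem exists_nsmul_eq_sum_of_tmul_eq_sum {K ι : Type*} [AddCommGroup K] [Fintype ι]
    (s : ι → K) (w : K) (a : ι → ℚ) (ha : ∀ i, 0 < a i)
    (hw : (1 : ℚ) ⊗ₜ[ℤ] w = ∑ i, a i • ((1 : ℚ) ⊗ₜ[ℤ] s i)) :
    ∃ (N : ℕ) (b : ι → ℤ), 1 ≤ N ∧ (∀ i, 1 ≤ b i) ∧ N • w = ∑ i, b i • s i := by
  obtain ⟨⟨D, hD⟩, hDa⟩ := IsLocalization.exist_integer_multiples_of_finite (nonZeroDivisors ℤ) a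
  choose b hb using hDa
  have hD0 : D ≠ 0 := nonZeroDivisors.ne_zero hD
  replace hb (i : ι) : (b i : ℚ) = D * a i := by simpa [Algebra.smul_def] using hb i
  have hz : TensorProduct.mk ℤ ℚ K 1 (D • w - ∑ i, b i • s i) = 0 := by
    rw [map_sub, map_sum, sub_eq_zero, map_smul, TensorProduct.mk_apply, hw, Finset.smul_sum]
    refine Finset.sum_congr rfl fun i _ ↦ ?_
    rw [map_smul, TensorProduct.mk_apply, ← Int.cast_smul_eq_zsmul ℚ, ← Int.cast_smul_eq_zsmul ℚ,
      hb, mul_smul]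
  obtain ⟨⟨E, hE⟩, hEz⟩ := (IsLocalizedModule.eq_zero_iff (nonZeroDivisors ℤ) _).mp hz
  have hE0 : E ≠ 0 := nonZeroDivisors.ne_zero hE
  replace hEz : E • D • w = ∑ i, E • b i • s i := by
    rw [← Finset.smul_sum, ← sub_eq_zero, ← smul_sub]
    exact hEz
  have hED : 0 < (E * D) ^ 2 := by positivity
  refine ⟨((E * D) ^ 2).toNat, fun i ↦ E ^ 2 * D * b i, by lia, fun i ↦ ?_, ?_⟩
  · have h : (0 : ℚ) < ((E ^ 2 * D * b i : ℤ) : ℚ) := by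
      push_cast
      rw [hb]
      have := ha i
      have hE' : (E : ℚ) ≠ 0 := mod_cast hE0
      have hD' : (D : ℚ) ≠ 0 := mod_cast hD0
      rw [show (E : ℚ) ^ 2 * D * (D * a i) = (E * D) ^ 2 * a i by ring]
      positivity
    have : 0 < E ^ 2 * D * b i := mod_cast h
    lia
  · rw [← natCast_zsmul, Int.toNat_of_nonneg hED.le,
      show (E * D) ^ 2 = (E * D) * (E * D) by ring, mul_smul, mul_smul E D w, hEz, Finset.smul_sum]
    refine Finset.sum_congr rfl fun i _ ↦ ?_
    simp only [smul_smul]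
    congr 1
    ring

theorem AddSubmonoid.sum_zsmul_mem_closure_range {K ι : Type*} [AddCommGroup K] [Fintype ι]
    (s : ι → K) (e : ι → ℤ) (he : ∀ i, 0 ≤ e i) :
    ∑ i, e i • s i ∈ AddSubmonoid.closure (Set.range s) := by
  refine _root_.sum_mem fun i _ ↦ ?_
  rw [← Int.toNat_of_nonneg (he i), natCast_zsmul]
  exact nsmul_mem (AddSubmonoid.subset_closure (Set.mem_range_self i)) _

/-- Termination of Algorithm 2.10 (pointCondIdeal): if `S` is a spanning
finitely generated submonoid of the finitely generated abelian group `K`,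
generated by `s₁, …, s_t`, and `w ⊗ 1` lies in the relative interior of
`cone(S)` (a strictly positive rational combination of the `sᵢ ⊗ 1`), then
some positive multiple `r • w` lies in the conductor ideal `c(S̃/S)`. -/
theorem multiple_mem_conductorIdeal {K : Type} [AddCommGroup K]
    (hK : AddGroup.FG K) (S : AddSubmonoid K)
    (t : ℕ) (s : Fin t → K) (hgen : AddSubmonoid.closure (Set.range s) = S)
    (hspan : AddSubgroup.closure (S : Set K) = ⊤)
    (w : K) (a : Fin t → ℚ) (ha : ∀ i, 0 < a i)
    (hw : (1 : ℚ) ⊗ₜ[ℤ] w = ∑ i, a i • ((1 : ℚ) ⊗ₜ[ℤ] s i)) :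
    ∃ r : ℕ, 1 ≤ r ∧ r • w ∈ conductorIdeal S := by
  subst hgen
  have hspan' : AddSubgroup.closure (Set.range s) = ⊤ := by
    rw [eq_top_iff, ← hspan, AddSubgroup.closure_le]
    exact (AddSubmonoid.closure_le (S := (AddSubgroup.closure (Set.range s)).toAddSubmonoid)).mpr
      AddSubgroup.subset_closure
  obtain ⟨M, hM⟩ := exists_forall_mem_saturation_eq_sum s hspan'
  obtain ⟨N, b, hN, hb, hNw⟩ := exists_nsmul_eq_sum_of_tmul_eq_sum s w a ha hw
  have hr : ((M + 1) * N) • w = ∑ i, (((M : ℤ) + 1) * b i) • s i := by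
    rw [mul_nsmul', hNw, Finset.smul_sum]
    refine Finset.sum_congr rfl fun i _ ↦ ?_
    rw [mul_smul, ← natCast_zsmul, Nat.cast_succ]
  have hpos (i : Fin t) : (M : ℤ) + 1 ≤ ((M : ℤ) + 1) * b i :=
    le_mul_of_one_le_right (by positivity) (hb i)
  refine ⟨(M + 1) * N, Nat.mul_pos M.succ_pos hN, ?_, fun x hx ↦ ?_⟩
  · rw [hr]
    exact AddSubmonoid.sum_zsmul_mem_closure_range s _ fun i ↦ by linarith [hpos i]
  · obtain ⟨e, he, rfl⟩ := hM x hx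
    rw [hr, ← Finset.sum_add_distrib]
    simp only [← add_smul]
    exact AddSubmonoid.sum_zsmul_mem_closure_range s _ fun i ↦ by linarith [hpos i, he i]
end

section
/- Let K be a finitely generated abelian group, let φ₁ : ℤ^{n₁} → K and φ₂ : ℤ^{n₂} → K be group homomorphisms, and set Sᵢ := φᵢ(ℕ^{nᵢ}) (the image of the nonnegative orthant), a submonoid of K. Let P := {(x, y) ∈ ℕ^{n₁} × ℕ^{n₂} : φ₁(x) = φ₂(y)}, a submonoid of ℕ^{n₁} × ℕ^{n₂} under addition. If a subset G ⊆ P generates the monoid P, then the set {φ₁(x) : (x, y) ∈ G} generates the monoid S₁ ∩ S₂. -/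
/-- Correctness of Algorithm 2.8 (generatorsIntMonoid): if
`G ⊆ P = {(x, y) ∈ ℕ^{n₁} × ℕ^{n₂} : φ₁ x = φ₂ y}` generates the monoid `P`,
then the images `φ₁ x` for `(x, y) ∈ G` generate the monoid `S₁ ∩ S₂`,
where `Sᵢ` is the image under `φᵢ` of the nonnegative orthant. -/
theorem generators_inter_monoid {K : Type} [AddCommGroup K]
    (hK : AddGroup.FG K) (n1 n2 : ℕ)
    (φ1 : (Fin n1 → ℤ) →+ K) (φ2 : (Fin n2 → ℤ) →+ K)
    (G : Set ((Fin n1 → ℤ) × (Fin n2 → ℤ)))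
    (hG : (AddSubmonoid.closure G : Set ((Fin n1 → ℤ) × (Fin n2 → ℤ))) =
      {p | (∀ i, 0 ≤ p.1 i) ∧ (∀ j, 0 ≤ p.2 j) ∧ φ1 p.1 = φ2 p.2}) :
    (AddSubmonoid.closure ((fun p => φ1 p.1) '' G) : Set K) =
      (⇑φ1 '' {x | ∀ i, 0 ≤ x i}) ∩ (⇑φ2 '' {y | ∀ j, 0 ≤ y j}) := by
  have hmap : AddSubmonoid.closure ((fun p => φ1 p.1) '' G) =
      (AddSubmonoid.closure G).map (φ1.comp (AddMonoidHom.fst _ (Fin n2 → ℤ))) :=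
    (AddMonoidHom.map_mclosure (φ1.comp (AddMonoidHom.fst _ (Fin n2 → ℤ))) G).symm
  rw [hmap, AddSubmonoid.coe_map, hG]
  ext k
  constructor
  · rintro ⟨⟨x, y⟩, ⟨hx, hy, hxy⟩, rfl⟩
    exact ⟨⟨x, hx, rfl⟩, ⟨y, hy, hxy.symm⟩⟩
  · rintro ⟨⟨x, hx, rfl⟩, ⟨y, hy, hxy⟩⟩
    exact ⟨(x, y), ⟨hx, hy, hxy.symm⟩, rfl⟩
end

section
/- Let K be a finitely generated abelian group, let S ⊆ K be a finitely generated submonoid that generates K as a group, with saturation S̃, and suppose there are finitely many group homomorphisms u₁, …, u_r : K → ℤ (r ≥ 1) such that S̃ = {x ∈ K : uᵢ(x) ≥ 0 for all i = 1, …, r}. Let 𝒦 ∈ K, let C ∈ c(S̃/S) be an element of the conductor ideal, let d ∈ ℕ, and set ν := max{uᵢ(C − 𝒦) : 1 ≤ i ≤ r}. Call an element 𝓛 ∈ K ample if uᵢ(𝓛) ≥ 1 for all i. Then the following are equivalent: (i) 𝒦 + m·𝓛 ∈ S for every integer m ≥ d + 1 and every ample 𝓛 ∈ K; (ii) 𝒦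 + m·𝓛 ∈ S for every integer m with d + 1 ≤ m ≤ ν − 1 and every ample 𝓛 ∈ K. -/
/-- Lemma 4.4 (boundm): let `S ⊆ K` be a spanning finitely generated
submonoid whose saturation is cut out by the integral linear forms
`u₁, …, u_r`, let `C` be a conductor element, `𝒦 ∈ K`, `d ∈ ℕ` and
`ν = max_i uᵢ(C - 𝒦)`. Calling `𝓛 ∈ K` ample when `uᵢ(𝓛) ≥ 1` for all `i`,
one has `𝒦 + m • 𝓛 ∈ S` for all `m ≥ d + 1` and all ample `𝓛` if and only
if this holds for all `d + 1 ≤ m ≤ ν - 1` and all ample `𝓛`. -/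
theorem fujita_bound_m {K : Type} [AddCommGroup K] (hK : AddGroup.FG K)
    (S : AddSubmonoid K) (hS : S.FG)
    (hspan : AddSubgroup.closure (S : Set K) = ⊤)
    (r : ℕ) (hr : 1 ≤ r) (u : Fin r → (K →+ ℤ))
    (hsat : saturation S = {x : K | ∀ i, 0 ≤ u i x})
    (𝒦 : K) (C : K) (hC : C ∈ conductorIdeal S) (d : ℕ)
    (ν : ℤ) (hν : IsGreatest (Set.range fun i => u i (C - 𝒦)) ν) :
    (∀ m : ℕ, d + 1 ≤ m → ∀ L : K, (∀ i, 1 ≤ u i L) → 𝒦 + m • L ∈ S) ↔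
      (∀ m : ℕ, d + 1 ≤ m → (m : ℤ) ≤ ν - 1 →
        ∀ L : K, (∀ i, 1 ≤ u i L) → 𝒦 + m • L ∈ S) := by
  refine ⟨fun h m hm _ L hL => h m hm L hL, fun h m hm L hL => ?_⟩
  by_cases hmν : (m : ℤ) ≤ ν - 1
  · exact h m hm hmν L hL
  have hmem : 𝒦 + m • L - C ∈ saturation S := by
    rw [hsat]
    intro i
    have hi : u i (C - 𝒦) ≤ ν := hν.2 ⟨i, rfl⟩
    have hmL : (m : ℤ) * 1 ≤ m * u i L := mul_le_mul_of_nonneg_left (hL i) (Int.natCast_nonneg m)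
    simp only [map_sub, map_add, map_nsmul, nsmul_eq_mul] at hi ⊢
    linarith
  simpa using hC.2 _ hmem
end

section
/- Let K be a finitely generated abelian group, let S ⊆ K be a finitely generated submonoid that generates K as a group, with saturation S̃, and suppose there are finitely many group homomorphisms u₁, …, u_r : K → ℤ (r ≥ 1) such that S̃ = {x ∈ K : uᵢ(x) ≥ 0 for all i = 1, …, r}. Let 𝒦 ∈ K, let C ∈ c(S̃/S) be an element of the conductor ideal, and set αᵢ := uᵢ(C − 𝒦) for each i. Call an element 𝓛 ∈ K ample if uⱼ(𝓛) ≥ 1 for all j. Then for every fixed integer m ≥ 1 the following are equivalent: (i) 𝒦 + m·𝓛 ∈ S for every ample 𝓛 ∈ K; (ii) for every 1 ≤ i ≤ r and every integer k with 1 ≤ k ≤ ⌊(αᵢ − 1)/m⌋, one has 𝒦 + m·𝓛 ∈ S for every ample 𝓛 ∈ K with uᵢ(𝓛) = k. -/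
/-- Lemma 4.5 (boundL1): let `S ⊆ K` be a spanning finitely generated
submonoid whose saturation is cut out by the integral linear forms
`u₁, …, u_r`, let `C` be a conductor element, `𝒦 ∈ K`, `αᵢ = uᵢ(C - 𝒦)` and
fix `m ≥ 1`. Calling `𝓛 ∈ K` ample when `uⱼ(𝓛) ≥ 1` for all `j`, one has
`𝒦 + m • 𝓛 ∈ S` for all ample `𝓛` if and only if `𝒦 + m • 𝓛 ∈ S` for all
`i`, all `1 ≤ k ≤ ⌊(αᵢ - 1)/m⌋`, and all ample `𝓛` with `uᵢ(𝓛) = k`. -/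
theorem fujita_bound_L {K : Type} [AddCommGroup K] (hK : AddGroup.FG K)
    (S : AddSubmonoid K) (hS : S.FG)
    (hspan : AddSubgroup.closure (S : Set K) = ⊤)
    (r : ℕ) (hr : 1 ≤ r) (u : Fin r → (K →+ ℤ))
    (hsat : saturation S = {x : K | ∀ i, 0 ≤ u i x})
    (𝒦 : K) (C : K) (hC : C ∈ conductorIdeal S)
    (m : ℕ) (hm : 1 ≤ m) :
    (∀ L : K, (∀ j, 1 ≤ u j L) → 𝒦 + m • L ∈ S) ↔
      (∀ i : Fin r, ∀ k : ℤ, 1 ≤ k → k ≤ Int.fdiv (u i (C - 𝒦) - 1) (m : ℤ) →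
        ∀ L : K, (∀ j, 1 ≤ u j L) → u i L = k → 𝒦 + m • L ∈ S) := by
  refine ⟨fun h _ _ _ _ L hL _ => h L hL, fun h L hL => ?_⟩
  by_cases hpos : ∀ i, 0 ≤ u i (𝒦 + m • L - C)
  · have hmem : 𝒦 + m • L - C ∈ saturation S := hsat ▸ hpos
    simpa using hC.2 _ hmem
  · push Not at hpos
    obtain ⟨i, hi⟩ := hpos
    refine h i (u i L) (hL i) ?_ L hL rfl
    have hm' : (0 : ℤ) < m := by exact_mod_cast hm
    rw [Int.fdiv_eq_ediv_of_nonneg _ hm'.le, Int.le_ediv_iff_mul_le hm']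
    simp only [map_sub, map_add, map_nsmul, nsmul_eq_mul] at hi ⊢
    linarith
end
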